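/- Let n ≥ 3 be odd. For each odd integer m > 1, let f_m(x) denote the minimal polynomial over ℚ of −1/(2 + 2cos(π/m)), rescaled so that its constant coefficient is 1. Then I(C_n,x) = Π_{m | n, m > 1} f_m(x), the product being over all divisors m of n with m > 1. -/

import Mathlib

open Polynomial SimpleGraph

/-- A finset of vertices is independent if no two of its vertices are adjacent. -/
def SimpleGraph.IsIndepFinset {V : Type*} (G : SimpleGraph V) (s : Finset V) : Prop :=
  ∀ v ∈ s, ∀ w ∈ s, ¬ G.Adj v w

open scoped Classical in
/-- The independence polynomial `I(G,x) = Σ_k i_k(G) xᵏ` of a finite simple graph,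
regarded as a polynomial with rational coefficients. -/
noncomputable def SimpleGraph.indepPoly {V : Type*} [Fintype V] (G : SimpleGraph V) :
    Polynomial ℚ :=
  ∑ s : Finset V, if G.IsIndepFinset s then (X : Polynomial ℚ) ^ s.card else 0

/-- `fPoly m` : the minimal polynomial over `ℚ` of `-1/(2 + 2cos(π/m))`, rescaled so
that its constant coefficient is `1`. -/
noncomputable def fPoly (m : ℕ) : Polynomial ℚ :=
  C ((minpoly ℚ (-1 / (2 + 2 * Real.cos (Real.pi / m)))).coeff 0)⁻¹ *
    minpoly ℚ (-1 / (2 + 2 * Real.cos (Real.pi / m)))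

/-- Transfer matrix. -/
noncomputable def tmA : Matrix Bool Bool ℚ[X] :=
  fun a b => if a ∧ b then 0 else if a then X else 1

/-- Lucas-type polynomials. -/
noncomputable def lucP : ℕ → ℚ[X]
  | 0 => 2
  | 1 => 1
  | (n + 2) => lucP (n + 1) + X * lucP n

theorem tmA_sq : tmA * tmA = tmA + (X : ℚ[X]) • (1 : Matrix Bool Bool ℚ[X]) := by
  ext1 a b
  cases a <;> cases b <;> simp [tmA, Matrix.mul_apply, add_comm]

theorem trace_tmA (n : ℕ) : (tmA ^ n).trace = lucP n := by
  induction n using lucP.induct with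
  | case1 => simp [lucP]
  | case2 => simp [lucP, tmA, Matrix.trace]
  | case3 n h1 h2 =>
    have : tmA ^ (n + 2) = tmA ^ (n + 1) + (X : ℚ[X]) • tmA ^ n := by
      rw [pow_add, pow_two, tmA_sq, mul_add, ← pow_succ]
      simp
    rw [lucP, ← h1, ← h2, Nat.succ_eq_add_one, this, Matrix.trace_add]
    simp

theorem walk_sum (k : ℕ) (v : Bool → ℚ[X]) (a : Bool) :
    ∑ τ : Fin k → Bool,
      (∏ i : Fin k, tmA ((Fin.cons a τ : Fin (k+1) → Bool) i.castSucc)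
        ((Fin.cons a τ : Fin (k+1) → Bool) i.succ)) *
        v ((Fin.cons a τ : Fin (k+1) → Bool) (Fin.last k)) = ((tmA ^ k).mulVec v) a := by
  induction k generalizing a with
  | zero => simp
  | succ k ih =>
    rw [← (Fin.consEquiv (fun _ : Fin (k+1) => Bool)).sum_comp, Fintype.sum_prod_type, pow_succ',
      ← Matrix.mulVec_mulVec]
    simp only [Matrix.mulVec, dotProduct]
    refine Finset.sum_congr rfl fun b _ => ?_
    have := ih b
    simp only [Matrix.mulVec, dotProduct] at this
    rw [← this, Finset.mul_sum]
    refine Finset.sum_congr rfl fun τ _ => ?_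
    rw [Fin.prod_univ_succ, ← mul_assoc]
    rfl

theorem cyc_sum (k : ℕ) :
    ∑ σ : Fin (k+1) → Bool, ∏ i, tmA (σ i) (σ (i+1)) = lucP (k+1) := by
  rw [← trace_tmA, ← (Fin.consEquiv (fun _ : Fin (k+1) => Bool)).sum_comp,
    Fintype.sum_prod_type, Matrix.trace]
  refine Finset.sum_congr rfl fun a _ => ?_
  have := walk_sum k (fun b => tmA b a) a
  rw [Matrix.diag, pow_succ, Matrix.mul_apply]
  simp only [Matrix.mulVec, dotProduct] at this
  rw [← this]
  refine Finset.sum_congr rfl fun τ _ => ?_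
  rw [Fin.prod_univ_castSucc]
  simp [Fin.consEquiv]

open scoped Classical in
theorem indep_eq (n : ℕ) : (cycleGraph (n+2)).indepPoly = lucP (n+2) := by
  rw [← cyc_sum (n+1), SimpleGraph.indepPoly]
  let e : Finset (Fin (n+2)) ≃ (Fin (n+2) → Bool) :=
    { toFun := fun s i => decide (i ∈ s)
      invFun := fun σ => Finset.univ.filter (fun i => σ i = true)
      left_inv := fun s => by ext; simp
      right_inv := fun σ => by ext; simp }
  rw [← e.sum_comp]
  refine Finset.sum_congr rfl fun s _ => ?_
  have he : ∀ i, e s i = decide (i ∈ s) := fun i => rfl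
  simp only [he, tmA, decide_eq_true_eq]
  have hiff : (cycleGraph (n+2)).IsIndepFinset s ↔ ∀ i, ¬ (i ∈ s ∧ i + 1 ∈ s) := by
    unfold SimpleGraph.IsIndepFinset
    constructor
    · rintro h i ⟨h1, h2⟩
      exact h i h1 _ h2 (by rw [cycleGraph_adj]; right; simp)
    · intro h v hv w hw hadj
      rw [cycleGraph_adj] at hadj
      rcases hadj with h1 | h1
      · exact h w ⟨hw, by rw [← h1]; simpa using hv⟩
      · exact h v ⟨hv, by rw [← h1]; simpa using hw⟩
  split_ifs with h
  · rw [hiff] at h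
    rw [Finset.prod_congr rfl (fun i _ => if_neg (h i))]
    rw [Finset.prod_ite]
    simp
  · rw [hiff] at h
    push Not at h
    obtain ⟨i, hi⟩ := h
    symm
    apply Finset.prod_eq_zero (Finset.mem_univ i)
    exact if_pos hi

theorem lucP_deg (n : ℕ) : 2 * (lucP n).natDegree ≤ n := by
  induction n using lucP.induct with
  | case1 => simp [lucP]
  | case2 => simp [lucP]
  | case3 n h1 h2 =>
    rw [lucP]
    have := natDegree_add_le (lucP (n+1)) (X * lucP n)
    have h3 := natDegree_mul_le (p := (X : ℚ[X])) (q := lucP n)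
    rw [natDegree_X] at h3
    have : (lucP (n+1) + X * lucP n).natDegree ≤ max (lucP (n+1)).natDegree (1 + (lucP n).natDegree) :=
      this.trans (max_le_max le_rfl h3)
    omega

theorem lucP_coeff (n : ℕ) : (lucP (n+1)).coeff 0 = 1 := by
  induction n with
  | zero => simp [lucP]
  | succ n ih => rw [lucP]; simp [ih]

theorem lucP_eval (l m : ℂ) (h : l + m = 1) (n : ℕ) : aeval (-(l * m)) (lucP n) = l ^ n + m ^ n := by
  induction n using lucP.induct with
  | case1 => simp only [lucP, map_ofNat, pow_zero]; norm_num
  | case2 => simp [lucP, h]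
  | case3 n h1 h2 =>
    rw [lucP, map_add, map_mul, aeval_X, h1, h2]
    have : m = 1 - l := by linear_combination h
    subst this
    rw [Nat.succ_eq_add_one]
    ring

theorem lucP_eval' (w : ℂ) (hw : w ≠ 1) (n : ℕ) (hn : Odd n) :
    aeval (w / (w - 1) ^ 2) (lucP n) = 0 ↔ w ^ n = 1 := by
  have h1 : (1 - w) ≠ 0 := fun h => hw (by linear_combination -h)
  have h1' : (w - 1) ≠ 0 := fun h => hw (by linear_combination h)
  have := lucP_eval (1 / (1 - w)) (-w / (1 - w)) (by field_simp; ring) n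
  have h2 : -(1 / (1 - w) * (-w / (1 - w))) = w / (w - 1) ^ 2 := by
    rw [show (w - 1)^2 = (1 - w)^2 by ring]; field_simp
  rw [h2] at this
  rw [this, div_pow, div_pow, ← add_div, div_eq_zero_iff, hn.neg_pow]
  simp only [pow_eq_zero_iff', h1, false_and, or_false, one_pow]
  constructor <;> intro h <;> linear_combination -h

/-- the number -/
noncomputable def alp (m : ℕ) : ℝ := -1 / (2 + 2 * Real.cos (Real.pi / m))

theorem exists_w (m : ℕ) (hm : Odd m) (h1 : 1 < m) :
    ∃ w : ℂ, IsPrimitiveRoot w m ∧ w ≠ 1 ∧ ((alp m : ℝ) : ℂ) = w / (w - 1) ^ 2 := by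
  obtain ⟨k, rfl⟩ := hm
  have hp := Complex.isPrimitiveRoot_exp_of_coprime (k+1) (2*k+1) (by omega) (by
    have : Nat.Coprime (k+1) (2*(k+1) - 1) := by
      rw [← Nat.isCoprime_iff_coprime]
      refine ⟨2, -1, ?_⟩
      push_cast [show 2*(k+1) - 1 = 2*k+1 by omega]; ring
    simpa [show 2*(k+1) - 1 = 2*k+1 by omega] using this)
  refine ⟨_, hp, hp.ne_one h1, ?_⟩
  have hne := hp.ne_one h1
  set w := Complex.exp (2 * Real.pi * Complex.I * ((k+1 : ℕ) / (2*k+1 : ℕ))) with hw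
  have hk : ((2*k+1 : ℕ) : ℂ) ≠ 0 := by exact_mod_cast (by omega : 2*k+1 ≠ 0)
  set z := Complex.exp (Real.pi / (2*k+1 : ℕ) * Complex.I) with hz
  have hz0 : z ≠ 0 := Complex.exp_ne_zero _
  have hwz : w = -z := by
    have : (2 * Real.pi * Complex.I * ((k+1 : ℕ) / (2*k+1 : ℕ)) : ℂ)
      = Real.pi / (2*k+1 : ℕ) * Complex.I + Real.pi * Complex.I := by
      field_simp; push_cast; ring
    rw [hw, this, Complex.exp_add, Complex.exp_pi_mul_I]; simp [hz]
  have hcos : (2 * Real.cos (Real.pi / (2*k+1 : ℕ)) : ℂ) = z + z⁻¹ := by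
    rw [hz, ← Complex.exp_neg, Complex.ofReal_cos, Complex.cos]
    push_cast
    ring_nf
  have hz1 : z + 1 ≠ 0 := fun h => hne (by rw [hwz]; linear_combination -h)
  have : ((alp (2*k+1) : ℝ) : ℂ) = -1 / (2 + 2 * Real.cos (Real.pi / (2*k+1 : ℕ)) : ℂ) := by
    unfold alp; push_cast; rfl
  rw [this, hcos, hwz]
  have e : (2 + (z + z⁻¹)) = (z + 1)^2 / z := by field_simp; ring
  rw [e]
  rw [show (-z - 1)^2 = (z + 1)^2 by ring]
  field_simp

theorem alp_root (m n : ℕ) (hm : Odd m) (h1 : 1 < m) (hn : Odd n) :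
    aeval (alp m) (lucP n) = 0 ↔ m ∣ n := by
  obtain ⟨w, hw, hw1, h⟩ := exists_w m hm h1
  rw [← hw.pow_eq_one_iff_dvd, ← lucP_eval' w hw1 n hn, ← h]
  have : ((alp m : ℝ) : ℂ) = algebraMap ℝ ℂ (alp m) := rfl
  rw [this, aeval_algebraMap_apply, map_eq_zero_iff _ (algebraMap ℝ ℂ).injective]

theorem lucP_ne (n : ℕ) (hn : 0 < n) : lucP n ≠ 0 := by
  obtain ⟨k, rfl⟩ := Nat.exists_eq_succ_of_ne_zero hn.ne'
  intro h
  have := lucP_coeff k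
  rw [Nat.succ_eq_add_one] at h
  rw [h] at this
  simp at this

theorem alp_int (m : ℕ) (hm : Odd m) (h1 : 1 < m) : IsIntegral ℚ (alp m) := by
  rw [← isAlgebraic_iff_isIntegral]
  exact ⟨lucP m, lucP_ne m (by omega), (alp_root m m hm h1 hm).2 dvd_rfl⟩

theorem alp_ne (m : ℕ) (hm : Odd m) (h1 : 1 < m) : alp m ≠ 0 := by
  obtain ⟨w, hw, hw1, h⟩ := exists_w m hm h1
  have : ((alp m : ℝ) : ℂ) ≠ 0 := by
    rw [h]
    exact div_ne_zero (hw.ne_zero (by omega)) (pow_ne_zero _ (sub_ne_zero.2 hw1))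
  exact_mod_cast this

theorem alp_deg (m : ℕ) (hm : Odd m) (h1 : 1 < m) :
    m.totient ≤ 2 * (minpoly ℚ (alp m)).natDegree := by
  obtain ⟨w, hw, hw1, h⟩ := exists_w m hm h1
  set p := minpoly ℚ (alp m) with hp
  have hmon : p.Monic := minpoly.monic (alp_int m hm h1)
  set d := p.natDegree with hd
  let q : ℚ[X] := ∑ k ∈ Finset.range (d+1), C (p.coeff k) * X ^ k * (X - 1) ^ (2 * (d - k))
  have hq1 : q.eval 1 = 1 := by
    simp only [q, eval_finsetSum]
    rw [Finset.sum_eq_single d]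
    · simp [hd, hmon.coeff_natDegree]
    · intro b hb hbd
      have : 2 * (d - b) ≠ 0 := by simp at hb; omega
      simp [this]
    · simp
  have hq0 : q ≠ 0 := by rintro h; simp [h] at hq1
  have hqd : q.natDegree ≤ 2 * d := by
    refine natDegree_sum_le_of_forall_le _ _ fun k hk => ?_
    have hk' : k ≤ d := by simp at hk; omega
    have hX : (X - 1 : ℚ[X]).natDegree = 1 := by
      simpa using natDegree_X_sub_C (1:ℚ)
    calc _ ≤ (C (p.coeff k) * X ^ k).natDegree + ((X - 1 : ℚ[X]) ^ (2 * (d - k))).natDegree :=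
          natDegree_mul_le
      _ ≤ k + 2 * (d - k) := by
          refine add_le_add (natDegree_C_mul_X_pow_le _ _) ?_
          rw [natDegree_pow, hX, mul_one]
      _ ≤ 2 * d := by omega
  have hw1' : w - 1 ≠ 0 := sub_ne_zero.2 hw1
  have hqw : aeval w q = 0 := by
    have hroot : aeval (w / (w-1)^2) p = 0 := by
      rw [← h]
      have : ((alp m : ℝ) : ℂ) = algebraMap ℝ ℂ (alp m) := rfl
      rw [this, aeval_algebraMap_apply, hp, minpoly.aeval, map_zero]
    have : aeval w q = (w-1)^(2*d) * aeval (w / (w-1)^2) p := by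
      rw [aeval_eq_sum_range (p := p), Finset.mul_sum, map_sum]
      refine Finset.sum_congr rfl fun k hk => ?_
      have hk' : k ≤ d := by simp at hk; omega
      obtain ⟨j, hj⟩ := Nat.exists_eq_add_of_le hk'
      rw [hj, Nat.add_sub_cancel_left]
      simp only [map_mul, aeval_C, map_pow, aeval_X, map_sub, map_one, Algebra.smul_def]
      rw [mul_add, pow_add, pow_mul _ 2 k, div_pow]
      field_simp
    rw [this, hroot, mul_zero]
  have hle := natDegree_le_of_dvd (minpoly.dvd ℚ w hqw) hq0
  rw [← cyclotomic_eq_minpoly_rat hw (by omega), natDegree_cyclotomic] at hle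
  omega

theorem fPoly_eq (m : ℕ) : fPoly m = C ((minpoly ℚ (alp m)).coeff 0)⁻¹ * minpoly ℚ (alp m) := rfl

theorem alp_dvd (m n : ℕ) (hm : Odd m) (h1 : 1 < m) (hn : Odd n) (hn1 : 1 < n)
    (h : minpoly ℚ (alp m) ∣ minpoly ℚ (alp n)) : m ∣ n := by
  rw [← alp_root m n hm h1 hn, ← minpoly.dvd_iff]
  exact h.trans (minpoly.dvd _ _ ((alp_root n n hn hn1 hn).2 dvd_rfl))

/-- For odd `n ≥ 3`, `I(C_n,x) = Π_{m ∣ n, m > 1} f_m(x)`. -/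
theorem indepPoly_cycle_eq_prod_fPoly (n : ℕ) (hn : 3 ≤ n) (hodd : Odd n) :
    (cycleGraph n).indepPoly = ∏ m ∈ n.divisors.filter (fun m => 1 < m), fPoly m := by
  have hL : (cycleGraph n).indepPoly = lucP n := by
    obtain ⟨k, rfl⟩ := Nat.exists_eq_add_of_le' (show 2 ≤ n by omega)
    exact indep_eq k
  rw [hL]
  have hS : ∀ m ∈ n.divisors.filter (fun m => 1 < m), Odd m ∧ 1 < m ∧ m ∣ n := by
    intro m hm
    simp only [Finset.mem_filter, Nat.mem_divisors] at hm
    exact ⟨hodd.of_dvd_nat hm.1.1, hm.2, hm.1.1⟩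
  have hc0 : ∀ m ∈ n.divisors.filter (fun m => 1 < m), (minpoly ℚ (alp m)).coeff 0 ≠ 0 := by
    intro m hm
    obtain ⟨h1, h2, h3⟩ := hS m hm
    exact minpoly.coeff_zero_ne_zero (alp_int m h1 h2) (alp_ne m h1 h2)
  have hassoc : ∀ m ∈ n.divisors.filter (fun m => 1 < m),
      Associated (minpoly ℚ (alp m)) (fPoly m) := by
    intro m hm
    rw [fPoly_eq]
    exact (associated_unit_mul_left _ _ (isUnit_C.2 (inv_ne_zero (hc0 m hm)).isUnit)).symm
  have hdvd : ∏ m ∈ n.divisors.filter (fun m => 1 < m), fPoly m ∣ lucP n := by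
    refine Finset.prod_dvd_of_coprime ?_ ?_
    · intro a ha b hb hab
      obtain ⟨a1, a2, a3⟩ := hS a ha
      obtain ⟨b1, b2, b3⟩ := hS b hb
      have ia := minpoly.irreducible (alp_int a a1 a2)
      have ib := minpoly.irreducible (alp_int b b1 b2)
      change IsCoprime (fPoly a) (fPoly b)
      have key : IsCoprime (minpoly ℚ (alp a)) (minpoly ℚ (alp b)) := by
        rw [ia.coprime_iff_not_dvd]
        intro hd
        have hd' := (ia.associated_of_dvd ib hd).symm.dvd
        exact hab (Nat.dvd_antisymm (alp_dvd a b a1 a2 b1 b2 hd) (alp_dvd b a b1 b2 a1 a2 hd'))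
      exact (key.of_isCoprime_of_dvd_left (hassoc a ha).symm.dvd).of_isCoprime_of_dvd_right
        (hassoc b hb).symm.dvd
    · intro m hm
      obtain ⟨h1, h2, h3⟩ := hS m hm
      exact (hassoc m hm).symm.dvd.trans (minpoly.dvd _ _ ((alp_root m n h1 h2 hodd).2 h3))
  obtain ⟨Q, hQ⟩ := hdvd
  set P := ∏ m ∈ n.divisors.filter (fun m => 1 < m), fPoly m with hP
  have hne := lucP_ne n (by omega)
  have hP0 : P ≠ 0 := by rintro h; rw [h, zero_mul] at hQ; exact hne hQ
  have hQ0 : Q ≠ 0 := by rintro h; rw [h, mul_zero] at hQ; exact hne hQ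
  have hdegP : n ≤ 2 * P.natDegree + 1 := by
    rw [hP, natDegree_prod _ _ (Finset.prod_ne_zero_iff.1 hP0), Finset.mul_sum]
    have h1 : ∑ m ∈ n.divisors.filter (fun m => 1 < m), m.totient ≤
        ∑ m ∈ n.divisors.filter (fun m => 1 < m), 2 * (fPoly m).natDegree := by
      refine Finset.sum_le_sum fun m hm => ?_
      obtain ⟨h1, h2, h3⟩ := hS m hm
      rw [fPoly_eq, natDegree_C_mul (inv_ne_zero (hc0 m hm))]
      exact alp_deg m h1 h2
    have h2 := Nat.sum_totient n
    rw [← Finset.sum_filter_add_sum_filter_not _ (fun m => 1 < m)] at h2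
    have h3 : n.divisors.filter (fun m => ¬ 1 < m) ⊆ {1} := by
      intro m hm
      simp only [Finset.mem_filter, Nat.mem_divisors] at hm
      have := Nat.pos_of_dvd_of_pos hm.1.1 (by omega)
      simp; omega
    have h4 := Finset.sum_le_sum_of_subset (f := Nat.totient) h3
    simp only [Finset.sum_singleton, Nat.totient_one] at h4
    omega
  have hdQ : Q.natDegree = 0 := by
    have h1 := lucP_deg n
    rw [hQ, natDegree_mul hP0 hQ0] at h1
    obtain ⟨k, rfl⟩ := hodd
    omega
  have hPc : P.coeff 0 = 1 := by
    rw [hP, coeff_zero_prod]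
    refine Finset.prod_eq_one fun m hm => ?_
    rw [fPoly_eq, coeff_C_mul, inv_mul_cancel₀ (hc0 m hm)]
  have hLc : (lucP n).coeff 0 = 1 := by
    obtain ⟨k, rfl⟩ := Nat.exists_eq_add_of_le' (show 1 ≤ n by omega)
    exact lucP_coeff k
  rw [hQ, mul_coeff_zero, hPc, one_mul] at hLc
  rw [hQ, eq_C_of_natDegree_eq_zero hdQ, hLc, map_one, mul_one]
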